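/- arXiv:1608.00641 — 4 statements merged into one kernel-verified Lean document; each statement's English description precedes it below -/
import Mathlib

section
/- Suppose x ∈ Δ and there exists an index i ∉ σ(x) such that (Ax)_i > xᵀAx − α Σ_{j∉S} x_j². Then x is not a local maximizer of f_S^α over Δ. -/
open Matrix Finset

/-- First-order condition: at a local maximizer `x` of a quadratic form over a convex set, no
feasible direction is an ascent direction. -/
theorem dotProduct_mulVec_nonpos_of_isLocalMaxOn {ι : Type*} [Fintype ι]
    {B : Matrix ι ι ℝ} (hB : B.IsSymm) {K : Set (ι → ℝ)} (hK : Convex ℝ K)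
    {x y : ι → ℝ} (hx : x ∈ K) (hy : y ∈ K)
    (hmax : IsLocalMaxOn (fun z => z ⬝ᵥ B.mulVec z) K x) :
    (y - x) ⬝ᵥ B.mulVec x ≤ 0 := by
  have hcont : Continuous fun t : ℝ => x + t • (y - x) := by fun_prop
  have hpath : Filter.Tendsto (fun t : ℝ => x + t • (y - x))
      (nhdsWithin 0 (Set.Ioi 0)) (nhdsWithin x K) := by
    refine tendsto_nhdsWithin_iff.2 ⟨?_, ?_⟩
    · simpa using hcont.continuousAt.tendsto.mono_left (nhdsWithin_le_nhds (a := (0 : ℝ)))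
    · filter_upwards [Ioc_mem_nhdsGT (zero_lt_one' ℝ)] with t ht
      exact hK.add_smul_sub_mem hx hy ⟨ht.1.le, ht.2⟩
  have hquot : ∀ᶠ t : ℝ in nhdsWithin 0 (Set.Ioi 0),
      2 * ((y - x) ⬝ᵥ B.mulVec x) + t * ((y - x) ⬝ᵥ B.mulVec (y - x)) ≤ 0 := by
    filter_upwards [hpath.eventually hmax, self_mem_nhdsWithin] with t ht htpos
    have hswap : x ⬝ᵥ B.mulVec (y - x) = (y - x) ⬝ᵥ B.mulVec x := by
      rw [dotProduct_mulVec, ← mulVec_transpose, hB.eq, dotProduct_comm]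
    simp only [mulVec_add, mulVec_smul, dotProduct_add, add_dotProduct, smul_dotProduct,
      dotProduct_smul, smul_eq_mul, hswap] at ht
    refine nonpos_of_mul_nonpos_right (a := t) ?_ htpos
    linarith
  have hlim : Filter.Tendsto (fun t : ℝ => 2 * ((y - x) ⬝ᵥ B.mulVec x) +
      t * ((y - x) ⬝ᵥ B.mulVec (y - x))) (nhdsWithin 0 (Set.Ioi 0))
      (nhds (2 * ((y - x) ⬝ᵥ B.mulVec x))) := by
    have h : Continuous fun t : ℝ => 2 * ((y - x) ⬝ᵥ B.mulVec x) +
      t * ((y - x) ⬝ᵥ B.mulVec (y - x)) := by fun_prop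
    simpa using h.continuousAt.tendsto.mono_left (nhdsWithin_le_nhds (a := (0 : ℝ)))
  linarith [le_of_tendsto hlim hquot]

open Matrix Finset

/-- If there is an index `i` outside the support of `x` whose payoff `(Ax)_i` strictly
exceeds `xᵀAx − α ∑_{j∉S} x_j²`, then `x` is not a local maximizer of `f_S^α` over the
standard simplex. -/
theorem not_local_max_of_violated_kkt
    (n : ℕ) (hn : 1 ≤ n) (A : Matrix (Fin n) (Fin n) ℝ)
    (hsymm : A.IsSymm) (hnonneg : ∀ i j, 0 ≤ A i j) (hdiag : ∀ i, A i i = 0)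
    (S : Finset (Fin n)) (α : ℝ) (hα : 0 < α)
    (x : Fin n → ℝ) (hx : x ∈ stdSimplex ℝ (Fin n))
    (i : Fin n) (hi : ¬ 0 < x i)
    (hgt : A.mulVec x i > x ⬝ᵥ A.mulVec x - α * ∑ j ∈ Sᶜ, (x j)^2) :
    ¬ IsLocalMaxOn
      (fun y => y ⬝ᵥ (A - α • Matrix.diagonal
          (fun k => if k ∈ S then (0:ℝ) else 1)).mulVec y)
      (stdSimplex ℝ (Fin n)) x := by
  intro hmax
  have hxi : x i = 0 := le_antisymm (not_lt.1 hi) (hx.1 i)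
  have hsym : (A - α • Matrix.diagonal (fun k => if k ∈ S then (0 : ℝ) else 1)).IsSymm :=
    hsymm.sub ((isSymm_diagonal _).smul α)
  have hnonpos := dotProduct_mulVec_nonpos_of_isLocalMaxOn hsym (convex_stdSimplex ℝ (Fin n))
    hx (single_mem_stdSimplex ℝ i) hmax
  have hmask : x ⬝ᵥ (Matrix.diagonal (fun k => if k ∈ S then (0 : ℝ) else 1)).mulVec x =
      ∑ j ∈ Sᶜ, (x j) ^ 2 := by
    simp only [dotProduct, mulVec_diagonal, ← Finset.sum_filter_add_sum_filter_not univ (· ∈ S)]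
    rw [Finset.sum_eq_zero (by simp +contextual), zero_add]
    refine Finset.sum_congr (by ext; simp) fun j hj => ?_
    simp only [mem_compl] at hj
    simp [hj, sq]
  simp only [sub_dotProduct, single_dotProduct, one_mul, sub_mulVec, smul_mulVec, dotProduct_sub,
    dotProduct_smul, hmask, mulVec_diagonal, hxi, mul_zero,
    smul_eq_mul] at hnonpos
  linarith
end

section
/- (Proposition 1) Let S ⊆ V be nonempty, and suppose α > 0 satisfies: for every x ∈ Δ with σ(x) ⊆ V∖S, the quantity min_{i ∈ S} (xᵀAx − (Ax)_i)/(xᵀx) is strictly less than α (i.e., α exceeds γ_S, the maximum over x ∈ Δ_{V∖S} of min_{i ∈ S} (xᵀAx − (Ax)_i)/(xᵀx)). If x is a local maximizer of f_S^α over Δ, then σ(x) ∩ S ≠ ∅. -/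
open Matrix Finset

/-- First-order condition: the derivative of a symmetric quadratic form at a local maximizer on a
convex set is nonpositive in every feasible direction. -/
theorem dotProduct_mulVec_sub_nonpos_of_isLocalMaxOn {ι : Type*} [Fintype ι]
    {M : Matrix ι ι ℝ} (hM : M.IsSymm) {C : Set (ι → ℝ)} (hC : Convex ℝ C) {x y : ι → ℝ}
    (hx : x ∈ C) (hy : y ∈ C) (hmax : IsLocalMaxOn (fun z => z ⬝ᵥ M.mulVec z) C x) :
    (y - x) ⬝ᵥ M.mulVec x ≤ 0 := by
  set d := y - x
  have hsymm : x ⬝ᵥ M.mulVec d = d ⬝ᵥ M.mulVec x := by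
    rw [Matrix.dotProduct_mulVec, ← Matrix.mulVec_transpose, hM.eq, dotProduct_comm]
  have hcont : Continuous fun t : ℝ => x + t • d := by fun_prop
  have hpath : Filter.Tendsto (fun t : ℝ => x + t • d) (nhdsWithin 0 (Set.Ioi 0))
      (nhdsWithin x C) := by
    refine tendsto_nhdsWithin_iff.2 ⟨?_, ?_⟩
    · simpa using (hcont.tendsto 0).mono_left nhdsWithin_le_nhds
    · filter_upwards [Ioc_mem_nhdsGT (zero_lt_one' ℝ)] with t ht
      exact hC.add_smul_sub_mem hx hy ⟨ht.1.le, ht.2⟩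
  have hslope : ∀ᶠ t in nhdsWithin (0 : ℝ) (Set.Ioi 0),
      2 * (d ⬝ᵥ M.mulVec x) + t * (d ⬝ᵥ M.mulVec d) ≤ 0 := by
    filter_upwards [hpath.eventually hmax, self_mem_nhdsWithin] with t ht htpos
    simp only [Matrix.mulVec_add, Matrix.mulVec_smul, add_dotProduct, dotProduct_add,
      smul_dotProduct, dotProduct_smul, smul_eq_mul, hsymm] at ht
    refine nonpos_of_mul_nonpos_right ?_ (Set.mem_Ioi.1 htpos)
    linarith
  have hlim : Filter.Tendsto (fun t : ℝ => 2 * (d ⬝ᵥ M.mulVec x) + t * (d ⬝ᵥ M.mulVec d))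
      (nhdsWithin 0 (Set.Ioi 0)) (nhds (2 * (d ⬝ᵥ M.mulVec x))) := by
    have h : Continuous fun t : ℝ => 2 * (d ⬝ᵥ M.mulVec x) + t * (d ⬝ᵥ M.mulVec d) := by
      fun_prop
    simpa using (h.tendsto 0).mono_left nhdsWithin_le_nhds
  linarith [le_of_tendsto hlim hslope]

/-- Proposition 1: if `α` strictly dominates, for every `y ∈ Δ` supported in `V∖S`, the
minimum over `i ∈ S` of `(yᵀAy − (Ay)_i)/(yᵀy)`, then every local maximizer of `f_S^α`
over the standard simplex has support intersecting `S`. -/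
theorem support_meets_S_of_local_max
    (n : ℕ) (hn : 1 ≤ n) (A : Matrix (Fin n) (Fin n) ℝ)
    (hsymm : A.IsSymm) (hnonneg : ∀ i j, 0 ≤ A i j) (hdiag : ∀ i, A i i = 0)
    (S : Finset (Fin n)) (hS : S.Nonempty) (α : ℝ) (hα : 0 < α)
    (hgamma : ∀ y ∈ stdSimplex ℝ (Fin n), (∀ i ∈ S, y i = 0) →
      S.inf' hS (fun i => (y ⬝ᵥ A.mulVec y - A.mulVec y i) / (y ⬝ᵥ y)) < α)
    (x : Fin n → ℝ) (hx : x ∈ stdSimplex ℝ (Fin n))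
    (hmax : IsLocalMaxOn
      (fun y => y ⬝ᵥ (A - α • Matrix.diagonal
          (fun k => if k ∈ S then (0:ℝ) else 1)).mulVec y)
      (stdSimplex ℝ (Fin n)) x) :
    ∃ i ∈ S, 0 < x i := by
  by_contra! hneg
  have hzero : ∀ i ∈ S, x i = 0 := fun i hi => le_antisymm (hneg i hi) (hx.1 i)
  obtain ⟨i, hi, hlt⟩ := (Finset.inf'_lt_iff hS).1 (hgamma x hx hzero)
  have hxne : x ≠ 0 := by
    rintro rfl
    simpa using hx.2
  have hpos : 0 < x ⬝ᵥ x :=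
    lt_of_le_of_ne (Finset.sum_nonneg fun k _ => mul_self_nonneg (x k))
      (Ne.symm (mt dotProduct_self_eq_zero.1 hxne))
  rw [div_lt_iff₀ hpos] at hlt
  have hproj : (Matrix.diagonal fun k => if k ∈ S then (0 : ℝ) else 1).mulVec x = x := by
    ext k
    by_cases hk : k ∈ S <;> simp [Matrix.mulVec_diagonal, hk, hzero]
  have hfirst := dotProduct_mulVec_sub_nonpos_of_isLocalMaxOn
    (hsymm.sub ((Matrix.isSymm_diagonal _).smul α)) (convex_stdSimplex ℝ (Fin n)) hx
    (single_mem_stdSimplex ℝ i) hmax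
  simp only [Matrix.sub_mulVec, Matrix.smul_mulVec, hproj, sub_dotProduct, dotProduct_sub,
    dotProduct_smul, single_dotProduct, smul_eq_mul, hzero i hi, one_mul, mul_zero] at hfirst
  linarith
end

section
/- (Proposition 2) Let S ⊆ V be nonempty with V∖S nonempty. Then for every x ∈ Δ with σ(x) ⊆ V∖S, the quantity min_{i ∈ S} (xᵀAx − (Ax)_i)/(xᵀx) is at most λ_max(A_{V∖S}), the largest eigenvalue of the principal submatrix of A indexed by the elements of V∖S. Consequently γ_S = max_{x ∈ Δ_{V∖S}} min_{i ∈ S} (xᵀAx − (Ax)_i)/(xᵀx) ≤ λ_max(A_{V∖S}). -/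
open Matrix Finset

open scoped MatrixOrder in
/-- The Rayleigh bound for a real symmetric matrix: its quadratic form is at most its largest
eigenvalue times the squared Euclidean norm. -/
theorem Matrix.IsHermitian.dotProduct_mulVec_le_iSup_eigenvalues {m : Type*} [Fintype m]
    [DecidableEq m] {M : Matrix m m ℝ} (hM : M.IsHermitian) (y : m → ℝ) :
    y ⬝ᵥ M *ᵥ y ≤ (⨆ k, hM.eigenvalues k) * (y ⬝ᵥ y) := by
  have hle : M ≤ algebraMap ℝ _ (⨆ k, hM.eigenvalues k) := by
    refine le_algebraMap_of_spectrum_le (fun r hr => ?_) hM.isSelfAdjoint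
    rw [hM.spectrum_real_eq_range_eigenvalues] at hr
    obtain ⟨k, rfl⟩ := hr
    exact le_ciSup (Set.finite_range _).bddAbove k
  have h := (Matrix.le_iff.mp hle).dotProduct_mulVec_nonneg y
  simpa [sub_mulVec, Algebra.algebraMap_eq_smul_one, smul_mulVec] using h

/-- A sum of a function vanishing on `S` equals the sum over the subtype of the complement. -/
theorem Finset.sum_subtype_notMem_of_eq_zero {ι M : Type*} [Fintype ι] [DecidableEq ι]
    [AddCommMonoid M] (S : Finset ι) {f : ι → M} (hf : ∀ i ∈ S, f i = 0) :
    ∑ i : {i // i ∉ S}, f i = ∑ i, f i := by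
  rw [← Finset.sum_subtype Sᶜ (fun i => Finset.mem_compl) f]
  refine Finset.sum_subset (Finset.subset_univ _) fun i _ hi => hf i ?_
  simpa using hi

/-- Proposition 2: for every `x ∈ Δ` supported in `V∖S`, the minimum over `i ∈ S` of
`(xᵀAx − (Ax)_i)/(xᵀx)` is at most the largest eigenvalue of the principal submatrix
`A_{V∖S}`.  Consequently `γ_S ≤ λ_max(A_{V∖S})`. -/
theorem gamma_le_lambda_max
    (n : ℕ) (hn : 1 ≤ n) (A : Matrix (Fin n) (Fin n) ℝ)
    (hsymm : A.IsSymm) (hnonneg : ∀ i j, 0 ≤ A i j) (hdiag : ∀ i, A i i = 0)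
    (S : Finset (Fin n)) (hS : S.Nonempty) (hSc : Sᶜ.Nonempty)
    (hHerm : (A.submatrix (Subtype.val : {i : Fin n // i ∉ S} → Fin n)
        Subtype.val).IsHermitian) :
    ∀ x ∈ stdSimplex ℝ (Fin n), (∀ i ∈ S, x i = 0) →
      S.inf' hS (fun i => (x ⬝ᵥ A.mulVec x - A.mulVec x i) / (x ⬝ᵥ x)) ≤
        ⨆ k, hHerm.eigenvalues k := by
  intro x hx hxS
  obtain ⟨i, hi⟩ := hS
  refine (Finset.inf'_le _ hi).trans ?_
  have hx0 : x ≠ 0 := by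
    rintro rfl
    simpa using hx.2
  have hpos : 0 < x ⬝ᵥ x := by simpa using dotProduct_star_self_pos_iff.mpr hx0
  have hAx : 0 ≤ (A *ᵥ x) i :=
    dotProduct_nonneg_of_nonneg (hnonneg i) hx.1
  have hsq : (fun j : {j // j ∉ S} => x j) ⬝ᵥ (fun j => x j) = x ⬝ᵥ x :=
    S.sum_subtype_notMem_of_eq_zero (f := fun j => x j * x j) fun j hj => by simp [hxS j hj]
  have hmul (j : {j // j ∉ S}) :
      (A.submatrix Subtype.val Subtype.val *ᵥ fun k : {k // k ∉ S} => x k) j = (A *ᵥ x) j :=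
    S.sum_subtype_notMem_of_eq_zero (f := fun k => A j k * x k) fun k hk => by simp [hxS k hk]
  have hquad : (fun j : {j // j ∉ S} => x j) ⬝ᵥ
      (A.submatrix Subtype.val Subtype.val *ᵥ fun j : {j // j ∉ S} => x j) = x ⬝ᵥ A *ᵥ x := by
    rw [funext hmul]
    exact S.sum_subtype_notMem_of_eq_zero (f := fun j => x j * (A *ᵥ x) j)
      fun j hj => by simp [hxS j hj]
  have hray := hHerm.dotProduct_mulVec_le_iSup_eigenvalues fun j => x j
  rw [hquad, hsq] at hray
  rw [div_le_iff₀ hpos]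
  linarith
end

section
/- Let S ⊆ V be nonempty with V∖S nonempty, and suppose α > λ_max(A_{V∖S}), the largest eigenvalue of the principal submatrix of A indexed by V∖S. Then every local maximizer x of f_S^α over Δ satisfies σ(x) ∩ S ≠ ∅; that is, the support of every local solution of the program maximize xᵀ(A − α Î_S)x subject to x ∈ Δ necessarily contains elements of S. -/
open Matrix Finset

open scoped MatrixOrder Matrix.Norms.L2Operator Topology in
/-- The Rayleigh bound: the quadratic form of a real symmetric matrix is at most its largest
eigenvalue times the squared Euclidean norm. -/
theorem Matrix.IsHermitian.dotProduct_mulVec_le_iSup_eigenvalues_s7 {m : Type*} [Fintype m]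
    [DecidableEq m] {B : Matrix m m ℝ} (hB : B.IsHermitian) (z : m → ℝ) :
    z ⬝ᵥ B *ᵥ z ≤ (⨆ k, hB.eigenvalues k) * (z ⬝ᵥ z) := by
  have hle : B ≤ algebraMap ℝ (Matrix m m ℝ) (⨆ k, hB.eigenvalues k) := by
    refine le_algebraMap_of_spectrum_le (fun r hr => ?_) hB.isSelfAdjoint
    rw [hB.spectrum_real_eq_range_eigenvalues] at hr
    obtain ⟨k, rfl⟩ := hr
    exact le_ciSup (Set.finite_range _).bddAbove k
  have h := (Matrix.le_iff.mp hle).dotProduct_mulVec_nonneg z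
  rw [Algebra.algebraMap_eq_smul_one, sub_mulVec, smul_mulVec, one_mulVec, dotProduct_sub,
    dotProduct_smul, star_trivial, smul_eq_mul] at h
  linarith

/-- A sum over a finite type of a function vanishing on `S` is the sum over the complement. -/
theorem sum_eq_sum_subtype_notMem {ι : Type*} [Fintype ι] [DecidableEq ι] (S : Finset ι)
    (f : ι → ℝ) (hf : ∀ i ∈ S, f i = 0) : ∑ i, f i = ∑ i : {i // i ∉ S}, f i := by
  rw [← Finset.sum_subtype Sᶜ (by simp) f]
  exact (Finset.sum_subset (Finset.subset_univ _) fun i _ hi => hf i (by simpa using hi)).symm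

/-- The quadratic form of a matrix at a vector vanishing on `S` only sees the principal submatrix
indexed by the complement of `S`. -/
theorem dotProduct_mulVec_eq_submatrix {ι : Type*} [Fintype ι] [DecidableEq ι] (S : Finset ι)
    (A : Matrix ι ι ℝ) (x : ι → ℝ) (hx : ∀ i ∈ S, x i = 0) :
    x ⬝ᵥ A *ᵥ x = (fun i : {i // i ∉ S} => x i) ⬝ᵥ
      A.submatrix Subtype.val Subtype.val *ᵥ fun i : {i // i ∉ S} => x i := by
  simp only [dotProduct, mulVec, submatrix_apply]
  rw [sum_eq_sum_subtype_notMem S _ fun i hi => by simp [hx i hi]]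
  refine Finset.sum_congr rfl fun i _ => ?_
  rw [sum_eq_sum_subtype_notMem S _ fun j hj => by simp [hx j hj]]

/-- The quadratic form of a symmetric matrix along the segment from `x` to the `j`-th vertex of
the simplex. -/
theorem Matrix.IsSymm.dotProduct_mulVec_segment {ι : Type*} [Fintype ι] [DecidableEq ι]
    {M : Matrix ι ι ℝ} (hM : M.IsSymm) (x : ι → ℝ) (j : ι) (t : ℝ) :
    ((1 - t) • x + t • Pi.single j 1) ⬝ᵥ M *ᵥ ((1 - t) • x + t • Pi.single j 1) =
      (1 - t) ^ 2 * (x ⬝ᵥ M *ᵥ x) + 2 * t * (1 - t) * (M *ᵥ x) j + t ^ 2 * M j j := by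
  have h : x ⬝ᵥ M.col j = (M *ᵥ x) j := by
    rw [dotProduct_comm, mulVec, Matrix.col_def, hM.eq]
  simp only [mulVec_add, mulVec_smul, dotProduct_add, add_dotProduct, smul_dotProduct,
    dotProduct_smul, single_one_dotProduct, mulVec_single_one, h, smul_eq_mul, col_apply]
  ring

open scoped Topology in
/-- If `x` is a local maximizer of a quadratic form on the simplex and neither the gradient nor
the diagonal entry at some vertex `j` is negative, then the value at `x` is nonnegative. -/
theorem nonneg_of_isLocalMaxOn_stdSimplex {ι : Type*} [Fintype ι] [DecidableEq ι]
    {M : Matrix ι ι ℝ} (hM : M.IsSymm) {x : ι → ℝ} (hx : x ∈ stdSimplex ℝ ι)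
    (hmax : IsLocalMaxOn (fun y => y ⬝ᵥ M *ᵥ y) (stdSimplex ℝ ι) x)
    {j : ι} (hgrad : 0 ≤ (M *ᵥ x) j) (hj : 0 ≤ M j j) : 0 ≤ x ⬝ᵥ M *ᵥ x := by
  let y : ℝ → ι → ℝ := fun t => (1 - t) • x + t • Pi.single j 1
  have hIoo : Set.Ioo (0 : ℝ) 1 ∈ 𝓝[>] 0 := Ioo_mem_nhdsGT one_pos
  have hy : Filter.Tendsto y (𝓝[>] 0) (𝓝[stdSimplex ℝ ι] x) := by
    refine tendsto_nhdsWithin_iff.mpr ⟨?_, ?_⟩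
    · have hc : Continuous y := by fun_prop
      have h0 := hc.tendsto 0
      simp only [y, sub_zero, one_smul, zero_smul, add_zero] at h0
      exact h0.mono_left nhdsWithin_le_nhds
    · filter_upwards [hIoo] with t ht
      exact convex_stdSimplex ℝ ι hx (single_mem_stdSimplex ℝ j) (by linarith [ht.2]) ht.1.le
        (by ring)
  obtain ⟨t, hle, ht0, ht1⟩ := ((hy.eventually hmax).and hIoo).exists
  have hseg := hM.dotProduct_mulVec_segment x j t
  have h1 : 0 ≤ 2 * t * (1 - t) * (M *ᵥ x) j :=
    mul_nonneg (mul_nonneg (by linarith) (by linarith)) hgrad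
  have h2 : 0 ≤ t ^ 2 * M j j := by positivity
  have h3 : (1 - t) ^ 2 * (x ⬝ᵥ M *ᵥ x) ≤ x ⬝ᵥ M *ᵥ x := by
    simp only [y] at hle
    linarith
  by_contra! hneg
  nlinarith [mul_pos ht0 (show 0 < 2 - t by linarith)]

/-- If `α > λ_max(A_{V∖S})`, then every local maximizer of `f_S^α` over the standard
simplex has support containing elements of `S`. -/
theorem support_meets_S_of_alpha_gt_lambda_max
    (n : ℕ) (hn : 1 ≤ n) (A : Matrix (Fin n) (Fin n) ℝ)
    (hsymm : A.IsSymm) (hnonneg : ∀ i j, 0 ≤ A i j) (hdiag : ∀ i, A i i = 0)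
    (S : Finset (Fin n)) (hS : S.Nonempty) (hSc : Sᶜ.Nonempty)
    (hHerm : (A.submatrix (Subtype.val : {i : Fin n // i ∉ S} → Fin n)
        Subtype.val).IsHermitian)
    (α : ℝ) (hα : α > ⨆ k, hHerm.eigenvalues k)
    (x : Fin n → ℝ) (hx : x ∈ stdSimplex ℝ (Fin n))
    (hmax : IsLocalMaxOn
      (fun y => y ⬝ᵥ (A - α • Matrix.diagonal
          (fun k => if k ∈ S then (0:ℝ) else 1)).mulVec y)
      (stdSimplex ℝ (Fin n)) x) :
    ∃ i ∈ S, 0 < x i := by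
  by_contra! hcon
  have hx0 : ∀ i ∈ S, x i = 0 := fun i hi => le_antisymm (hcon i hi) (hx.1 i)
  obtain ⟨j, hj⟩ := hS
  set D : Matrix (Fin n) (Fin n) ℝ :=
    Matrix.diagonal (fun k => if k ∈ S then (0 : ℝ) else 1) with hD
  have hM : (A - α • D).IsSymm := hsymm.sub ((isSymm_diagonal _).smul α)
  have hDx : D *ᵥ x = x := by
    ext i
    rw [hD, mulVec_diagonal]
    split_ifs with hi <;> simp [hx0, hi]
  have hMx : (A - α • D) *ᵥ x = A *ᵥ x - α • x := by
    rw [sub_mulVec, smul_mulVec, hDx]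
  have hgrad : 0 ≤ ((A - α • D) *ᵥ x) j := by
    rw [hMx, Pi.sub_apply, Pi.smul_apply, hx0 j hj, smul_zero, sub_zero]
    show 0 ≤ ∑ i, A j i * x i
    exact Finset.sum_nonneg fun i _ => mul_nonneg (hnonneg j i) (hx.1 i)
  have hjj : 0 ≤ (A - α • D) j j := by simp [hD, hj, hdiag]
  have hnn := nonneg_of_isLocalMaxOn_stdSimplex hM hx hmax hgrad hjj
  rw [hMx, dotProduct_sub, dotProduct_smul, smul_eq_mul] at hnn
  have hray := hHerm.dotProduct_mulVec_le_iSup_eigenvalues_s7 fun i => x i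
  rw [← dotProduct_mulVec_eq_submatrix S A x hx0] at hray
  have hsq : x ⬝ᵥ x = (fun i : {i // i ∉ S} => x i) ⬝ᵥ fun i => x i :=
    sum_eq_sum_subtype_notMem S _ fun i hi => by simp [hx0 i hi]
  rw [← hsq] at hray
  have hpos : 0 < x ⬝ᵥ x := by
    refine lt_of_le_of_ne (Finset.sum_nonneg fun i _ => mul_self_nonneg (x i)) fun h => ?_
    have hsum := hx.2
    simp [dotProduct_self_eq_zero.mp h.symm] at hsum
  nlinarith [mul_lt_mul_of_pos_right hα hpos]
end
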